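/- Let g be a Lorentzian symmetric bilinear form on a real vector space V of finite dimension n ≥ 2, and let H be a compact connected subgroup of GL(V) with g(hx,hy) = g(x,y) for all h ∈ H and x,y ∈ V. Then there exist a positive definite symmetric bilinear form h on V with h(ax,ay) = h(x,y) for all a ∈ H, a nonzero linear functional η on V with η(ax) = η(x) for all a ∈ H, and a real number λ > 0, such that g = h − λ η ⊗ η. -/

import Mathlib

/-- A bilinear form `g` on a real vector space `V` is Lorentzian (of signature `(1, n-1)`)
if there exist `t ∈ V` and a subspace `W` with `V = ℝt ⊕ W`, `g t t < 0`, `g t w = 0` for all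
`w ∈ W`, and the restriction of `g` to `W` positive definite. -/
def IsLorentzian {V : Type*} [AddCommGroup V] [Module ℝ V]
    (g : V →ₗ[ℝ] V →ₗ[ℝ] ℝ) : Prop :=
  ∃ (t : V) (W : Submodule ℝ V),
    IsCompl (Submodule.span ℝ ({t} : Set V)) W ∧
    g t t < 0 ∧ (∀ w ∈ W, g t w = 0) ∧ (∀ w ∈ W, w ≠ 0 → 0 < g w w)

/-- A nonzero vector orthogonal to a timelike vector is spacelike. -/
theorem IsLorentzian.pos_of_orthogonal {V : Type*} [AddCommGroup V] [Module ℝ V]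
    {g : V →ₗ[ℝ] V →ₗ[ℝ] ℝ} (hg : IsLorentzian g) (hsymm : ∀ x y, g x y = g y x)
    {x y : V} (hx : g x x < 0) (hxy : g x y = 0) (hy : y ≠ 0) : 0 < g y y := by
  obtain ⟨t, W, hc, ht, hW, hpos⟩ := hg
  have decomp : ∀ v : V, ∃ a : ℝ, ∃ w ∈ W, v = a • t + w := by
    intro v
    have hv : v ∈ Submodule.span ℝ ({t} : Set V) ⊔ W := by rw [hc.sup_eq_top]; trivial
    obtain ⟨u, hu, w, hw, rfl⟩ := Submodule.mem_sup.1 hv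
    obtain ⟨a, rfl⟩ := Submodule.mem_span_singleton.1 hu
    exact ⟨a, w, hw, rfl⟩
  have nonneg : ∀ w ∈ W, 0 ≤ g w w := by
    intro w hw
    rcases eq_or_ne w 0 with rfl | h
    · simp
    · exact (hpos w hw h).le
  obtain ⟨a, w, hw, hxw⟩ := decomp x
  obtain ⟨b, w', hw', hyw⟩ := decomp y
  have ha : a ≠ 0 := by
    rintro rfl
    rw [zero_smul, zero_add] at hxw
    rw [hxw] at hx
    exact absurd hx (nonneg w hw).not_gt
  rcases eq_or_ne b 0 with rfl | hb
  · rw [zero_smul, zero_add] at hyw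
    rw [hyw] at hy ⊢
    exact hpos w' hw' hy
  · have hz : b • x - a • y ∈ W := by
      have : b • x - a • y = b • w - a • w' := by rw [hxw, hyw]; module
      rw [this]
      exact W.sub_mem (W.smul_mem _ hw) (W.smul_mem _ hw')
    have h1 := nonneg _ hz
    have hyx : g y x = 0 := by rw [hsymm, hxy]
    simp only [map_sub, map_smul, LinearMap.sub_apply, LinearMap.smul_apply, smul_eq_mul,
      hxy, hyx] at h1
    have hb2 : 0 < b ^ 2 := by positivity
    have ha2 : 0 < a ^ 2 := by positivity
    have h2 : 0 < a ^ 2 * g y y := by nlinarith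
    exact pos_of_mul_pos_right h2 ha2.le

/-- Two causal vectors in the same closed half-cone as a timelike vector `t` pair nonpositively. -/
theorem IsLorentzian.apply_nonpos {V : Type*} [AddCommGroup V] [Module ℝ V]
    {g : V →ₗ[ℝ] V →ₗ[ℝ] ℝ} (hg : IsLorentzian g) (hsymm : ∀ x y, g x y = g y x)
    {t x y : V} (ht : g t t < 0) (hx : g x x ≤ 0) (htx : g t x ≤ 0)
    (hy : g y y ≤ 0) (hty : g t y ≤ 0) : g x y ≤ 0 := by
  by_contra! hxy
  have hy0 : y ≠ 0 := by rintro rfl; simp at hxy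
  have hs : g (g x y • t - g t y • x) (g x y • t - g t y • x) < 0 := by
    simp only [map_sub, map_smul, LinearMap.sub_apply, LinearMap.smul_apply, smul_eq_mul,
      hsymm x t]
    have h1 : g x y ^ 2 * g t t < 0 := mul_neg_of_pos_of_neg (by positivity) ht
    have h2 : g t y ^ 2 * g x x ≤ 0 := mul_nonpos_of_nonneg_of_nonpos (by positivity) hx
    have h3 : 0 ≤ g x y * (g t y * g t x) :=
      mul_nonneg hxy.le (mul_nonneg_of_nonpos_of_nonpos hty htx)
    nlinarith
  have hsy : g (g x y • t - g t y • x) y = 0 := by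
    simp only [map_sub, map_smul, LinearMap.sub_apply, LinearMap.smul_apply, smul_eq_mul]
    ring
  exact absurd (hg.pos_of_orthogonal hsymm hs hsy hy0) hy.not_gt

/-- The closed half-cone of causal vectors determined by a timelike vector is convex. -/
theorem IsLorentzian.convex_halfCone {V : Type*} [AddCommGroup V] [Module ℝ V]
    {g : V →ₗ[ℝ] V →ₗ[ℝ] ℝ} (hg : IsLorentzian g) (hsymm : ∀ x y, g x y = g y x)
    {t : V} (ht : g t t < 0) : Convex ℝ {x : V | g x x ≤ 0 ∧ g t x ≤ 0} := by
  rintro x ⟨hx, htx⟩ y ⟨hy, hty⟩ a b ha hb -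
  have hxy := hg.apply_nonpos hsymm ht hx htx hy hty
  simp only [Set.mem_ofPred_eq, map_add, map_smul, LinearMap.add_apply, LinearMap.smul_apply,
    smul_eq_mul, hsymm y x]
  have h1 := mul_nonpos_of_nonneg_of_nonpos (mul_nonneg ha ha) hx
  have h2 := mul_nonpos_of_nonneg_of_nonpos (mul_nonneg hb hb) hy
  have h3 := mul_nonpos_of_nonneg_of_nonpos (mul_nonneg ha hb) hxy
  have h4 := mul_nonpos_of_nonneg_of_nonpos ha htx
  have h5 := mul_nonpos_of_nonneg_of_nonpos hb hty
  constructor <;> linarith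

/-- On a convex subset of a causal half-cone, a timelike minimizer of `x ↦ g x x` is unique. -/
theorem IsLorentzian.eq_of_isMinOn {V : Type*} [AddCommGroup V] [Module ℝ V]
    {g : V →ₗ[ℝ] V →ₗ[ℝ] ℝ} (hg : IsLorentzian g) (hsymm : ∀ x y, g x y = g y x)
    {t : V} (ht : g t t < 0) {K : Set V} (hK : Convex ℝ K)
    (hKC : K ⊆ {x : V | g x x ≤ 0 ∧ g t x ≤ 0}) {x y : V} (hx : x ∈ K) (hy : y ∈ K)
    (hneg : g x x < 0) (hmin : IsMinOn (fun z => g z z) K x) (hxy : g y y = g x x) :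
    y = x := by
  have hnonpos := hg.apply_nonpos hsymm ht (hKC hx).1 (hKC hx).2 (hKC hy).1 (hKC hy).2
  have hmid := isMinOn_iff.1 hmin _
    (hK hx hy (by norm_num : (0 : ℝ) ≤ 1 / 2) (by norm_num : (0 : ℝ) ≤ 1 / 2) (by norm_num))
  simp only [map_add, map_smul, LinearMap.add_apply, LinearMap.smul_apply, smul_eq_mul,
    hsymm y x, hxy] at hmid
  by_contra hne
  have hsum : g (x + y) (x + y) < 0 := by
    simp only [map_add, LinearMap.add_apply, hsymm y x, hxy]; linarith
  have horth : g (x + y) (y - x) = 0 := by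
    simp only [map_add, map_sub, LinearMap.add_apply, hsymm y x, hxy]; ring
  have hdiff := hg.pos_of_orthogonal hsymm hsum horth (sub_ne_zero.2 hne)
  simp only [map_sub, LinearMap.sub_apply, hsymm y x, hxy] at hdiff
  linarith

/-- A compact connected group of linear isometries of a Lorentzian form fixes a timelike vector. -/
theorem IsLorentzian.exists_fixed_timelike {V : Type*} [NormedAddCommGroup V]
    [NormedSpace ℝ V] [FiniteDimensional ℝ V] {g : V →ₗ[ℝ] V →ₗ[ℝ] ℝ}
    (hg : IsLorentzian g) (hsymm : ∀ x y, g x y = g y x)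
    (H : Subgroup (V →L[ℝ] V)ˣ) (hH : IsCompact (H : Set (V →L[ℝ] V)ˣ))
    (hconn : IsConnected (H : Set (V →L[ℝ] V)ˣ))
    (hinv : ∀ h ∈ H, ∀ x y : V, g ((h : V →L[ℝ] V) x) ((h : V →L[ℝ] V) y) = g x y) :
    ∃ x : V, g x x < 0 ∧ ∀ h ∈ H, (h : V →L[ℝ] V) x = x := by
  obtain ⟨t, -, -, ht, -⟩ := id hg
  have hcont : Continuous fun h : (V →L[ℝ] V)ˣ => (h : V →L[ℝ] V) t :=
    (ContinuousLinearMap.apply ℝ V t).continuous.comp Units.continuous_val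
  set S : Set V := (fun h : (V →L[ℝ] V)ˣ => (h : V →L[ℝ] V) t) '' H
  have htS : t ∈ S := ⟨1, H.one_mem, by simp⟩
  have hSC : S ⊆ {x : V | g x x ≤ 0 ∧ g t x ≤ 0} := by
    rintro _ ⟨h, hh, rfl⟩
    refine ⟨(hinv h hh t t).trans_le ht.le, ?_⟩
    by_contra! hpos
    have hf : Continuous fun h : (V →L[ℝ] V)ˣ => g t ((h : V →L[ℝ] V) t) :=
      (g t).continuous_of_finiteDimensional.comp hcont
    obtain ⟨k, hk, hk0⟩ := hconn.isPreconnected.intermediate_value H.one_mem hh hf.continuousOn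
      (show (0 : ℝ) ∈ Set.Icc _ _ from ⟨by simpa using ht.le, hpos.le⟩)
    have hkt := hinv k hk t t
    have hne : (k : V →L[ℝ] V) t ≠ 0 := by
      intro h0
      rw [h0, map_zero] at hkt
      exact ht.ne hkt.symm
    have := hg.pos_of_orthogonal hsymm ht hk0 hne
    linarith
  have hq : Continuous fun x : V => g x x := by
    have h1 : Continuous fun x : V => LinearMap.toContinuousLinearMap (g x) :=
      (LinearMap.toContinuousLinearMap.toLinearMap ∘ₗ g).continuous_of_finiteDimensional
    exact h1.clm_apply continuous_id
  have hclosed : IsClosed {x : V | g x x ≤ 0 ∧ g t x ≤ 0} :=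
    (isClosed_le hq continuous_const).inter
      (isClosed_le (g t).continuous_of_finiteDimensional continuous_const)
  have hKC := closedConvexHull_min hSC (hg.convex_halfCone hsymm ht) hclosed
  have hcompact : IsCompact (closedConvexHull ℝ S) := by
    have := FiniteDimensional.proper_real V
    rw [closedConvexHull_eq_closure_convexHull]
    exact (isBounded_convexHull.2 (hH.image hcont).isBounded).isCompact_closure
  have htK : t ∈ closedConvexHull ℝ S := subset_closedConvexHull htS
  obtain ⟨x, hx, hmin⟩ := hcompact.exists_isMinOn ⟨t, htK⟩ hq.continuousOn
  have hneg : g x x < 0 := (isMinOn_iff.1 hmin t htK).trans_lt ht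
  refine ⟨x, hneg, fun h hh => ?_⟩
  have hmaps : closedConvexHull ℝ S ⊆ (h : V →L[ℝ] V) ⁻¹' closedConvexHull ℝ S := by
    refine closedConvexHull_min ?_
      (convex_closedConvexHull.linear_preimage ((h : V →L[ℝ] V) : V →ₗ[ℝ] V))
      (isClosed_closedConvexHull.preimage (h : V →L[ℝ] V).continuous)
    rintro _ ⟨k, hk, rfl⟩
    exact subset_closedConvexHull ⟨h * k, H.mul_mem hh hk, by simp⟩
  exact hg.eq_of_isMinOn hsymm ht convex_closedConvexHull hKC hx (hmaps hx) hneg hmin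
    (hinv h hh x x)

/-- Every Lorentzian symmetric bilinear form `g` invariant under a compact connected
subgroup `H ⊆ GL(V)` is of the form `g = h - λ η ⊗ η` for an `H`-invariant positive
definite symmetric bilinear form `h`, an `H`-invariant nonzero linear functional `η`,
and a real number `λ > 0`. -/
theorem stmt5 {n : ℕ} (hn : 2 ≤ n) {V : Type*} [NormedAddCommGroup V]
    [NormedSpace ℝ V] [FiniteDimensional ℝ V] (hdim : Module.finrank ℝ V = n)
    (g : V →ₗ[ℝ] V →ₗ[ℝ] ℝ) (hsymm : ∀ x y, g x y = g y x) (hg : IsLorentzian g)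
    (H : Subgroup (V →L[ℝ] V)ˣ) (hH : IsCompact (H : Set (V →L[ℝ] V)ˣ))
    (hconn : IsConnected (H : Set (V →L[ℝ] V)ˣ))
    (hinv : ∀ h ∈ H, ∀ x y : V, g ((h : V →L[ℝ] V) x) ((h : V →L[ℝ] V) y) = g x y) :
    ∃ (h : V →ₗ[ℝ] V →ₗ[ℝ] ℝ) (η : V →ₗ[ℝ] ℝ) (lam : ℝ),
      (∀ x y, h x y = h y x) ∧ (∀ x : V, x ≠ 0 → 0 < h x x) ∧
      (∀ a ∈ H, ∀ x y : V, h ((a : V →L[ℝ] V) x) ((a : V →L[ℝ] V) y) = h x y) ∧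
      η ≠ 0 ∧ (∀ a ∈ H, ∀ x : V, η ((a : V →L[ℝ] V) x) = η x) ∧
      0 < lam ∧ (∀ x y : V, g x y = h x y - lam * (η x * η y)) := by
  obtain ⟨τ, hτ, hfix⟩ := hg.exists_fixed_timelike hsymm H hH hconn hinv
  have hη : ∀ a ∈ H, ∀ x : V, g τ ((a : V →L[ℝ] V) x) = g τ x := by
    intro a ha x
    conv_lhs => rw [← hfix a ha]
    exact hinv a ha τ x
  set lam : ℝ := 2 / (-g τ τ)
  have hlam : 0 < lam := div_pos two_pos (neg_pos.2 hτ)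
  have happ : ∀ x y, (g + lam • (g τ).smulRight (g τ)) x y =
      g x y + lam * (g τ x * g τ y) := by
    intro x y
    simp
  refine ⟨g + lam • (g τ).smulRight (g τ), g τ, lam, ?_, ?_, ?_, ?_, hη, hlam, ?_⟩
  · intro x y
    rw [happ, happ, hsymm x y]
    ring
  · intro x hx
    rw [happ]
    have key : g τ τ * lam = -2 := by
      simp only [lam]
      field_simp [hτ.ne]
    rcases eq_or_ne (g τ x) 0 with h0 | h0
    · have := hg.pos_of_orthogonal hsymm hτ h0 hx
      simpa [h0] using this
    · have horth : g τ (g τ τ • x - g τ x • τ) = 0 := by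
        simp only [map_sub, map_smul, smul_eq_mul]; ring
      have hnonneg : 0 ≤ g (g τ τ • x - g τ x • τ) (g τ τ • x - g τ x • τ) := by
        rcases eq_or_ne (g τ τ • x - g τ x • τ) 0 with hz | hz
        · simp [hz]
        · exact (hg.pos_of_orthogonal hsymm hτ horth hz).le
      simp only [map_sub, map_smul, LinearMap.sub_apply, LinearMap.smul_apply, smul_eq_mul,
        hsymm x τ] at hnonneg
      have h2 : 0 < g τ x ^ 2 := by positivity
      have h3 : 0 ≤ (-g τ τ) * (g τ x ^ 2 - g τ τ * g x x) := by linarith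
      have h4 := nonneg_of_mul_nonneg_right h3 (neg_pos.2 hτ)
      have h5 : 0 < (-g τ τ) * (g x x + lam * (g τ x * g τ x)) := by
        have : (-g τ τ) * (g x x + lam * (g τ x * g τ x)) =
            -(g τ τ * g x x) - (g τ τ * lam) * g τ x ^ 2 := by ring
        rw [this, key]
        linarith
      exact pos_of_mul_pos_right h5 (neg_pos.2 hτ).le
  · intro a ha x y
    rw [happ, happ, hinv a ha, hη a ha, hη a ha]
  · intro h0
    rw [h0] at hτ
    simp at hτ
  · intro x y
    rw [happ]
    ring
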